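/- Let ν_k denote, for each integer k ≥ 1, the unique solution in ((k−1)π/2, kπ/2) of μ sin(2μ) = 2 cos(2μ). Then there exists a constant C > 0 such that for all k ≥ 1, |tan(ν_{2k−1}) − 1/(kπ)| ≤ C/k²; in particular there exists ε > 0 such that |tan(ν_{2k−1})| ≥ ε/k for all k ≥ 1. -/

import Mathlib

open Real Set

lemma neumann_aux (k : ℕ) (hk : 1 ≤ k) (μ : ℝ) (h1 : ((k:ℝ) - 1) * π < μ)
    (h2 : μ < (k:ℝ) * π - π / 2) (h : μ * Real.sin (2 * μ) = 2 * Real.cos (2 * μ)) :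
    1 / ((k:ℝ) * π) ≤ Real.tan μ ∧ Real.tan μ - 1 / ((k:ℝ) * π) ≤ 2 / (k:ℝ) ^ 2 := by
  have hpi := Real.pi_gt_three
  have hk1 : (1:ℝ) ≤ k := by exact_mod_cast hk
  have hμ : 0 < μ := lt_of_le_of_lt (mul_nonneg (by linarith) (by linarith)) h1
  have hper : Real.tan (μ - ((k - 1 : ℕ) : ℝ) * π) = Real.tan μ :=
    Real.tan_sub_nat_mul_pi μ (k - 1)
  rw [Nat.cast_sub hk, Nat.cast_one] at hper
  have ht : 0 < Real.tan μ := by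
    rw [← hper]
    exact Real.tan_pos_of_pos_of_lt_pi_div_two (by linarith) (by linarith)
  have hc : Real.cos μ ≠ 0 := by
    intro hc
    rw [Real.tan_eq_sin_div_cos, hc] at ht
    simp at ht
  have hs : Real.sin μ = Real.tan μ * Real.cos μ := (Real.tan_mul_cos hc).symm
  have heq : μ * Real.tan μ = 1 - Real.tan μ ^ 2 := by
    rw [Real.sin_two_mul, Real.cos_two_mul', hs] at h
    have : Real.cos μ ^ 2 ≠ 0 := pow_ne_zero 2 hc
    apply mul_right_cancel₀ this
    linarith
  generalize Real.tan μ = t at *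
  have hmt : 0 < μ * t := mul_pos hμ ht
  have ht1 : t < 1 := by nlinarith
  have hkp : 0 < (k:ℝ) * π := by positivity
  have hid : t * (k * π) - 1 = t * (k * π - μ - t) := by linarith
  have hkt : k * t ≤ 2 := by
    have : (k - 1) * π * t ≤ 1 := by nlinarith
    have h0 : 0 ≤ (k - 1) * t := mul_nonneg (by linarith) ht.le
    nlinarith
  constructor
  · rw [div_le_iff₀ hkp]
    nlinarith [mul_pos ht (show 0 < k * π - μ - t by linarith)]
  · have e : t - 1 / ((k:ℝ) * π) = t * (k * π - μ - t) / (k * π) := by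
      rw [← hid]; field_simp
    rw [e, div_le_div_iff₀ hkp (by positivity)]
    have h3 : t * (k * π - μ - t) ≤ t * π :=
      mul_le_mul_of_nonneg_left (by linarith) ht.le
    calc t * (k * π - μ - t) * (k:ℝ) ^ 2 ≤ t * π * (k:ℝ) ^ 2 :=
          mul_le_mul_of_nonneg_right h3 (by positivity)
      _ = (k * t) * (k * π) := by ring
      _ ≤ 2 * (k * π) := mul_le_mul_of_nonneg_right hkt hkp.le

/-- Asymptotics of the odd-index Neumann control input coefficients:
`tan(ν_{2k−1}) = 1/(kπ) + O(1/k²)`, and in particular `|tan(ν_{2k−1})| ≥ ε/k`. -/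
theorem neumann_input_coefficient_asymptotics (ν : ℕ → ℝ)
    (hν : ∀ k : ℕ, 1 ≤ k → ν k ∈ Ioo ((((k : ℝ)) - 1) * π / 2) (((k : ℝ)) * π / 2) ∧
      ν k * Real.sin (2 * ν k) = 2 * Real.cos (2 * ν k)) :
    (∃ C > 0, ∀ k : ℕ, 1 ≤ k →
      |Real.tan (ν (2 * k - 1)) - 1 / ((k : ℝ) * π)| ≤ C / (k : ℝ) ^ 2) ∧
    (∃ ε > 0, ∀ k : ℕ, 1 ≤ k → |Real.tan (ν (2 * k - 1))| ≥ ε / (k : ℝ)) := by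
  have key : ∀ k : ℕ, 1 ≤ k → 1 / ((k:ℝ) * π) ≤ Real.tan (ν (2 * k - 1)) ∧
      Real.tan (ν (2 * k - 1)) - 1 / ((k:ℝ) * π) ≤ 2 / (k:ℝ) ^ 2 := by
    intro k hk
    obtain ⟨⟨h1, h2⟩, h⟩ := hν (2 * k - 1) (by omega)
    rw [Nat.cast_sub (by omega)] at h1 h2
    push_cast at h1 h2
    exact neumann_aux k hk _ (by linarith) (by linarith) h
  refine ⟨⟨2, by norm_num, fun k hk => ?_⟩, ⟨1 / π, by positivity, fun k hk => ?_⟩⟩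
  · obtain ⟨h1, h2⟩ := key k hk
    rw [abs_of_nonneg (by linarith)]
    exact h2
  · obtain ⟨h1, h2⟩ := key k hk
    have e : 1 / π / (k:ℝ) = 1 / ((k:ℝ) * π) := by rw [div_div, mul_comm]
    rw [ge_iff_le, e]
    exact h1.trans (le_abs_self _)
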